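/- arXiv:2405.19863 — 2 statements merged into one kernel-verified Lean document; each statement's English description precedes it below -/
import Mathlib

section
/- Let (A,B) be a Katsura pair. The KEP-action (G_B, E_A) is contracting if and only if the KEP-action of the infinite part (A_∞, B_∞) is contracting. -/
open scoped Classical

/-- A Katsura pair on a vertex set `V`: matrices `A` (natural entries) and `B` (integer
entries) with `A i j = 0 → B i j = 0`. -/
structure KatsuraPair (V : Type) where
  A : V → V → ℕ
  B : V → V → ℤ
  zero : ∀ i j, A i j = 0 → B i j = 0

namespace KatsuraPair

variable {V : Type}

/-- An edge `e_{i,j,m}` (with `0 ≤ m < A i j`) of the graph `E_A`; the range is `i` and the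
source is `j`. -/
structure Edge (P : KatsuraPair V) where
  i : V
  j : V
  m : ℕ
  hm : m < P.A i j

variable {P : KatsuraPair V}

/-- A finite path `μ = μ₁⋯μₙ`: consecutive edges satisfy `s(μₜ) = r(μₜ₊₁)`. -/
def IsPath (μ : List (Edge P)) : Prop := μ.Chain' (fun e f => e.j = f.i)

/-- `r(μ) = v` (vacuously true for the empty path, viewed as a vertex). -/
def rangeIs (μ : List (Edge P)) (v : V) : Prop := ∀ e ∈ μ.head?, e.i = v

/-- The source of a path whose range is `v` (so `s` of the empty path at `v` is `v`). -/
def src (v : V) (μ : List (Edge P)) : V := (μ.getLast?).elim v (fun e => e.j)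

/-- `A_μ`, the product of the `A`-entries along `μ` (empty product is 1). -/
def Aprod (μ : List (Edge P)) : ℕ := (μ.map (fun e => P.A e.i e.j)).prod

/-- `B_μ`, the product of the `B`-entries along `μ` (empty product is 1). -/
def Bprod (μ : List (Edge P)) : ℤ := (μ.map (fun e => P.B e.i e.j)).prod

/-- `a^k · e_{i,j,m} = e_{i,j,m̂}` where `k·B i j + m = k̂·(A i j) + m̂`, `0 ≤ m̂ < A i j`. -/
def edgeAct (k : ℤ) (e : Edge P) : Edge P where
  i := e.i
  j := e.j
  m := ((k * P.B e.i e.j + (e.m : ℤ)) % (P.A e.i e.j : ℤ)).toNat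
  hm := by
    have hA : 0 < P.A e.i e.j := Nat.lt_of_le_of_lt (Nat.zero_le _) e.hm
    have hA' : (0 : ℤ) < (P.A e.i e.j : ℤ) := by exact_mod_cast hA
    have h1 : 0 ≤ (k * P.B e.i e.j + (e.m : ℤ)) % (P.A e.i e.j : ℤ) :=
      Int.emod_nonneg _ hA'.ne'
    have h2 : (k * P.B e.i e.j + (e.m : ℤ)) % (P.A e.i e.j : ℤ) < (P.A e.i e.j : ℤ) :=
      Int.emod_lt_of_pos _ hA'
    omega

/-- `a^k|_{e_{i,j,m}} = a^{k̂}` where `k·B i j + m = k̂·(A i j) + m̂`, `0 ≤ m̂ < A i j`. -/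
def edgeRes (k : ℤ) (e : Edge P) : ℤ := (k * P.B e.i e.j + (e.m : ℤ)) / (P.A e.i e.j : ℤ)

/-- The action of `a^k` on finite paths: `a^k · (eν) = (a^k · e)(a^k|_e · ν)`. -/
def act : ℤ → List (Edge P) → List (Edge P)
  | _, [] => []
  | k, e :: ν => edgeAct k e :: act (edgeRes k e) ν

/-- The restriction along a path: `a^k|_{eν} = (a^k|_e)|_ν`; `res k μ` is the integer with
`a^k|_μ = a^{res k μ}`. -/
def res : ℤ → List (Edge P) → ℤ
  | k, [] => k
  | k, e :: ν => res (edgeRes k e) ν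

/-- `a^k` and `a^l` act equally at the vertex `v`. -/
def ActEq (P : KatsuraPair V) (k l : ℤ) (v : V) : Prop :=
  ∀ μ : List (Edge P), IsPath μ → rangeIs μ v → act k μ = act l μ

/-- The KEP-action `(G_B, E_A)` is contracting. -/
def Contracting (P : KatsuraPair V) : Prop :=
  ∃ F : Finset ℤ, ∀ k : ℤ, ∀ v : V, ∃ n : ℕ, ∀ μ : List (Edge P),
    IsPath μ → rangeIs μ v → n ≤ μ.length →
    ∃ l ∈ F, ActEq P (res k μ) l (src v μ)

/-- The KEP-action `(G_B, E_A)` is regular. -/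
def Regular (P : KatsuraPair V) : Prop :=
  ∀ k : ℤ, ∀ v : V, ∃ K : ℕ, ∀ μ : List (Edge P),
    IsPath μ → rangeIs μ v → K ≤ μ.length → act k μ = μ →
    ActEq P (res k μ) 0 (src v μ)

/-- `v ∈ E⁰_{A,<∞}`: the quantity `A_μ / gcd(A_μ, |B_μ|)` is bounded over paths `μ` with
range `v` and `B_μ ≠ 0`. -/
def FiniteVertex (P : KatsuraPair V) (v : V) : Prop :=
  ∃ C : ℕ, ∀ μ : List (Edge P), IsPath μ → rangeIs μ v → Bprod μ ≠ 0 →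
    Aprod μ / Nat.gcd (Aprod μ) (Bprod μ).natAbs ≤ C

/-- An edge of `E_{A,∞}`: `B` nonzero and source in `E⁰_{A,∞}`. -/
def InfEdge (e : Edge P) : Prop := P.B e.i e.j ≠ 0 ∧ ¬ FiniteVertex P e.j

/-- An edge of `E_{A,<∞}`: `B` nonzero and range in `E⁰_{A,<∞}`. -/
def FinEdge (e : Edge P) : Prop := P.B e.i e.j ≠ 0 ∧ FiniteVertex P e.i

/-- The infinite part `(A_∞, B_∞)` of a Katsura pair. -/
def infinitePart (P : KatsuraPair V) : KatsuraPair {v : V // ¬ FiniteVertex P v} where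
  A := fun i j => if P.B i.1 j.1 = 0 then 0 else P.A i.1 j.1
  B := fun i j => P.B i.1 j.1
  zero := fun i j h => by
    by_cases hb : P.B i.1 j.1 = 0
    · exact hb
    · simp only [if_neg hb] at h
      exact P.zero _ _ h

/-- The finite part `(A_{<∞}, B_{<∞})` of a Katsura pair. -/
def finitePart (P : KatsuraPair V) : KatsuraPair {v : V // FiniteVertex P v} where
  A := fun i j => if P.B i.1 j.1 = 0 then 0 else P.A i.1 j.1
  B := fun i j => P.B i.1 j.1
  zero := fun i j h => by
    by_cases hb : P.B i.1 j.1 = 0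
    · exact hb
    · simp only [if_neg hb] at h
      exact P.zero _ _ h

end KatsuraPair

namespace KatsuraPair

variable {V : Type} {P : KatsuraPair V}

lemma Edge.ext_of_eq {e f : Edge P} (hi : e.i = f.i) (hj : e.j = f.j) (hm : e.m = f.m) :
    e = f := by
  cases e; cases f; simp_all

lemma Edge.A_pos (e : Edge P) : 0 < P.A e.i e.j := Nat.zero_lt_of_lt e.hm

lemma isPath_nil : IsPath ([] : List (Edge P)) := List.isChain_nil

lemma isPath_cons {e : Edge P} {μ : List (Edge P)} :
    IsPath (e :: μ) ↔ rangeIs μ e.j ∧ IsPath μ := by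
  refine List.isChain_cons.trans (and_congr_left fun _ => ?_)
  exact forall₂_congr fun _ _ => eq_comm

lemma rangeIs_nil (v : V) : rangeIs ([] : List (Edge P)) v := by
  simp [rangeIs]

lemma rangeIs_cons {e : Edge P} {μ : List (Edge P)} {v : V} :
    rangeIs (e :: μ) v ↔ e.i = v := by
  simp [rangeIs]

lemma src_cons (v : V) (e : Edge P) (μ : List (Edge P)) : src v (e :: μ) = src e.j μ := by
  cases μ with
  | nil => rfl
  | cons f ν =>
    simp only [src, List.getLast?_cons_cons]
    rw [List.getLast?_eq_getLast_of_ne_nil (List.cons_ne_nil f ν)]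
    rfl

lemma Aprod_cons (e : Edge P) (μ : List (Edge P)) :
    Aprod (e :: μ) = P.A e.i e.j * Aprod μ := by
  simp [Aprod]

lemma Bprod_cons (e : Edge P) (μ : List (Edge P)) :
    Bprod (e :: μ) = P.B e.i e.j * Bprod μ := by
  simp [Bprod]

lemma Aprod_pos (μ : List (Edge P)) : 0 < Aprod μ := by
  induction μ with
  | nil => simp [Aprod]
  | cons e μ ih => rw [Aprod_cons]; exact Nat.mul_pos e.A_pos ih

/-- A vertex is finite iff the fractions `B_μ / A_μ` have a common denominator. -/
lemma finiteVertex_iff {v : V} :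
    FiniteVertex P v ↔ ∃ M : ℕ, 0 < M ∧ ∀ μ : List (Edge P), IsPath μ → rangeIs μ v →
      (Aprod μ : ℤ) ∣ M * Bprod μ := by
  constructor
  · rintro ⟨C, hC⟩
    refine ⟨C.factorial, C.factorial_pos, fun μ hμ hv => ?_⟩
    by_cases hB : Bprod μ = 0
    · simp [hB]
    have hg : 0 < Nat.gcd (Aprod μ) (Bprod μ).natAbs := Nat.gcd_pos_of_pos_left _ (Aprod_pos μ)
    have hd : Aprod μ / Nat.gcd (Aprod μ) (Bprod μ).natAbs ∣ C.factorial :=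
      Nat.dvd_factorial (Nat.div_pos (Nat.le_of_dvd (Aprod_pos μ) (Nat.gcd_dvd_left _ _)) hg)
        (hC μ hμ hv hB)
    have h := mul_dvd_mul hd (Nat.gcd_dvd_right (Aprod μ) (Bprod μ).natAbs)
    rw [Nat.div_mul_cancel (Nat.gcd_dvd_left _ _)] at h
    rw [← Int.natAbs_dvd_natAbs, Int.natAbs_mul]
    simpa using h
  · rintro ⟨M, hM, h⟩
    refine ⟨M, fun μ hμ hv _ => ?_⟩
    have hg : 0 < Nat.gcd (Aprod μ) (Bprod μ).natAbs := Nat.gcd_pos_of_pos_left _ (Aprod_pos μ)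
    have h1 := h μ hμ hv
    rw [← Int.natAbs_dvd_natAbs, Int.natAbs_mul] at h1
    simp only [Int.natAbs_natCast] at h1
    have h2 : Aprod μ / Nat.gcd (Aprod μ) (Bprod μ).natAbs ∣
        M * ((Bprod μ).natAbs / Nat.gcd (Aprod μ) (Bprod μ).natAbs) := by
      rw [← Nat.mul_div_assoc _ (Nat.gcd_dvd_right _ _)]
      exact Nat.div_dvd_div (Nat.gcd_dvd_left _ _) h1
    exact Nat.le_of_dvd hM ((Nat.coprime_div_gcd_div_gcd hg).dvd_of_dvd_mul_right h2)

lemma FiniteVertex.of_edge {e : Edge P} (hB : P.B e.i e.j ≠ 0) (he : FiniteVertex P e.i) :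
    FiniteVertex P e.j := by
  rw [finiteVertex_iff] at he ⊢
  obtain ⟨M, hM, h⟩ := he
  refine ⟨M * (P.B e.i e.j).natAbs, Nat.mul_pos hM (Int.natAbs_pos.2 hB), fun ν hν hr => ?_⟩
  have h1 := h (e :: ν) (isPath_cons.2 ⟨hr, hν⟩) (rangeIs_cons.2 rfl)
  rw [Aprod_cons, Bprod_cons] at h1
  push_cast at h1 ⊢
  have h2 := (Dvd.intro_left _ rfl).trans h1
  rw [← mul_assoc] at h2
  rw [← dvd_abs, abs_mul, abs_mul] at h2 ⊢
  simpa using h2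

lemma FiniteVertex.src {μ : List (Edge P)} {v : V} (hv : FiniteVertex P v) (hμ : IsPath μ)
    (hr : rangeIs μ v) (hB : ∀ e ∈ μ, P.B e.i e.j ≠ 0) : FiniteVertex P (src v μ) := by
  induction μ generalizing v with
  | nil => exact hv
  | cons e μ ih =>
    rw [src_cons]
    rw [rangeIs_cons] at hr
    subst hr
    rw [isPath_cons] at hμ
    exact ih (hv.of_edge (hB e (by simp))) hμ.2 hμ.1 fun f hf => hB f (by simp [hf])

lemma edgeAct_eq_iff {k l : ℤ} {e : Edge P} :
    edgeAct k e = edgeAct l e ↔ (P.A e.i e.j : ℤ) ∣ (k - l) * P.B e.i e.j := by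
  have hA : (P.A e.i e.j : ℤ) ≠ 0 := by exact_mod_cast e.A_pos.ne'
  have key : (k * P.B e.i e.j + (e.m : ℤ)) % (P.A e.i e.j : ℤ) =
      (l * P.B e.i e.j + (e.m : ℤ)) % (P.A e.i e.j : ℤ) ↔
      (P.A e.i e.j : ℤ) ∣ (k - l) * P.B e.i e.j := by
    rw [eq_comm, ← Int.ModEq, Int.modEq_iff_dvd]
    ring_nf
  rw [← key]
  constructor
  · intro h
    have h1 := congrArg Edge.m h
    simp only [edgeAct] at h1
    rw [← Int.toNat_of_nonneg (Int.emod_nonneg _ hA), h1,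
      Int.toNat_of_nonneg (Int.emod_nonneg _ hA)]
  · intro h
    exact Edge.ext_of_eq rfl rfl (congrArg Int.toNat h)

lemma edgeRes_sub_mul {k l : ℤ} {e : Edge P}
    (h : (P.A e.i e.j : ℤ) ∣ (k - l) * P.B e.i e.j) :
    (edgeRes k e - edgeRes l e) * P.A e.i e.j = (k - l) * P.B e.i e.j := by
  have hA : (P.A e.i e.j : ℤ) ≠ 0 := by exact_mod_cast e.A_pos.ne'
  obtain ⟨c, hc⟩ := h
  have h1 : k * P.B e.i e.j + (e.m : ℤ) =
      (l * P.B e.i e.j + e.m) + P.A e.i e.j * c := by linarith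
  rw [edgeRes, edgeRes, h1, Int.add_mul_ediv_left _ _ hA, hc]
  ring

lemma actEq_of_dvd {k l : ℤ} {v : V}
    (h : ∀ μ : List (Edge P), IsPath μ → rangeIs μ v → (Aprod μ : ℤ) ∣ (k - l) * Bprod μ) :
    ActEq P k l v := by
  intro μ
  induction μ generalizing k l v with
  | nil => intros; rfl
  | cons e μ ih =>
    intro hμ hr
    rw [rangeIs_cons] at hr
    subst hr
    have he : (P.A e.i e.j : ℤ) ∣ (k - l) * P.B e.i e.j := by
      have := h [e] (isPath_cons.2 ⟨rangeIs_nil _, isPath_nil⟩) (rangeIs_cons.2 rfl)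
      simpa [Aprod, Bprod] using this
    have hA : (P.A e.i e.j : ℤ) ≠ 0 := by exact_mod_cast e.A_pos.ne'
    have hs := edgeRes_sub_mul he
    rw [isPath_cons] at hμ
    simp only [act]
    congr 1
    · exact edgeAct_eq_iff.2 he
    · refine ih (v := e.j) (fun ν hν hνr => ?_) hμ.2 hμ.1
      have h1 := h (e :: ν) (isPath_cons.2 ⟨hνr, hν⟩) (rangeIs_cons.2 rfl)
      rw [Aprod_cons, Bprod_cons, ← mul_assoc, ← hs] at h1
      push_cast at h1
      rw [mul_comm _ (P.A e.i e.j : ℤ), mul_assoc] at h1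
      exact Int.dvd_of_mul_dvd_mul_left hA h1

lemma ActEq.edge {k l : ℤ} {e : Edge P} (h : ActEq P k l e.i) :
    (P.A e.i e.j : ℤ) ∣ (k - l) * P.B e.i e.j ∧
      ActEq P (edgeRes k e) (edgeRes l e) e.j := by
  have key : ∀ μ : List (Edge P), IsPath μ → rangeIs μ e.j →
      edgeAct k e = edgeAct l e ∧ act (edgeRes k e) μ = act (edgeRes l e) μ := by
    intro μ hμ hr
    simpa [act] using h (e :: μ) (isPath_cons.2 ⟨hr, hμ⟩) (rangeIs_cons.2 rfl)
  exact ⟨edgeAct_eq_iff.1 (key [] isPath_nil (rangeIs_nil _)).1,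
    fun μ hμ hr => (key μ hμ hr).2⟩

lemma FiniteVertex.exists_actEq_emod {v : V} (hv : FiniteVertex P v) :
    ∃ M : ℕ, 0 < M ∧ ∀ k : ℤ, ActEq P k (k % M) v := by
  obtain ⟨M, hM, h⟩ := finiteVertex_iff.1 hv
  refine ⟨M, hM, fun k => actEq_of_dvd fun μ hμ hr => ?_⟩
  have hk : k - k % M = k / M * M := by
    have := Int.mul_ediv_add_emod k M
    linarith
  rw [hk, mul_assoc]
  exact (h μ hμ hr).mul_left _

lemma res_zero (μ : List (Edge P)) : res 0 μ = 0 := by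
  induction μ with
  | nil => rfl
  | cons e μ ih =>
    have : edgeRes 0 e = 0 := by
      simp only [edgeRes, zero_mul, zero_add]
      exact Int.ediv_eq_zero_of_lt (by positivity) (by exact_mod_cast e.hm)
    rw [res, this, ih]

lemma res_eq_zero {k : ℤ} {μ : List (Edge P)} (h : ∃ e ∈ μ, P.B e.i e.j = 0) :
    res k μ = 0 := by
  induction μ generalizing k with
  | nil => simp at h
  | cons e μ ih =>
    obtain ⟨f, hf, hB⟩ := h
    rw [res]
    rcases List.mem_cons.1 hf with rfl | hf
    · have : edgeRes k f = 0 := by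
        simp only [edgeRes, hB, mul_zero, zero_add]
        exact Int.ediv_eq_zero_of_lt (by positivity) (by exact_mod_cast f.hm)
      rw [this, res_zero]
    · exact ih ⟨f, hf, hB⟩

lemma B_ne_zero_of_edge_infinitePart (e : Edge (infinitePart P)) : P.B e.i.1 e.j.1 ≠ 0 := by
  intro h
  have := e.hm
  simp [infinitePart, h] at this

lemma infinitePart_A_of_edge (e : Edge (infinitePart P)) :
    (infinitePart P).A e.i e.j = P.A e.i.1 e.j.1 :=
  if_neg (B_ne_zero_of_edge_infinitePart e)

/-- The inclusion of the edges of the infinite part. -/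
def liftEdge (e : Edge (infinitePart P)) : Edge P where
  i := e.i.1
  j := e.j.1
  m := e.m
  hm := infinitePart_A_of_edge e ▸ e.hm

lemma liftEdge_injective : Function.Injective (liftEdge (P := P)) := by
  intro e f h
  exact Edge.ext_of_eq (Subtype.ext (congrArg Edge.i h)) (Subtype.ext (congrArg Edge.j h))
    (show (liftEdge e).m = (liftEdge f).m by rw [h])

lemma exists_liftEdge {e : Edge P} (hB : P.B e.i e.j ≠ 0) (hi : ¬ FiniteVertex P e.i)
    (hj : ¬ FiniteVertex P e.j) :
    ∃ e' : Edge (infinitePart P), e'.i = ⟨e.i, hi⟩ ∧ e'.j = ⟨e.j, hj⟩ ∧ liftEdge e' = e :=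
  ⟨⟨⟨e.i, hi⟩, ⟨e.j, hj⟩, e.m, e.hm.trans_eq (if_neg hB).symm⟩,
    rfl, rfl, rfl⟩

lemma edgeRes_liftEdge (k : ℤ) (e : Edge (infinitePart P)) :
    edgeRes k (liftEdge e) = edgeRes k e := by
  simp only [edgeRes, infinitePart_A_of_edge]
  rfl

lemma edgeAct_liftEdge (k : ℤ) (e : Edge (infinitePart P)) :
    edgeAct k (liftEdge e) = liftEdge (edgeAct k e) := by
  refine Edge.ext_of_eq rfl rfl ?_
  simp only [edgeAct, liftEdge, infinitePart_A_of_edge]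
  rfl

lemma res_map_liftEdge (k : ℤ) (μ : List (Edge (infinitePart P))) :
    res k (μ.map liftEdge) = res k μ := by
  induction μ generalizing k with
  | nil => rfl
  | cons e μ ih => simp only [List.map_cons, res, ih, edgeRes_liftEdge]

lemma act_map_liftEdge (k : ℤ) (μ : List (Edge (infinitePart P))) :
    act k (μ.map liftEdge) = (act k μ).map liftEdge := by
  induction μ generalizing k with
  | nil => rfl
  | cons e μ ih => simp only [List.map_cons, act, ih, edgeRes_liftEdge, edgeAct_liftEdge]

lemma rangeIs.map_liftEdge {μ : List (Edge (infinitePart P))} {v : {v // ¬ FiniteVertex P v}}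
    (h : rangeIs μ v) : rangeIs (μ.map liftEdge) v.1 := by
  cases μ with
  | nil => exact rangeIs_nil _
  | cons e μ => exact rangeIs_cons.2 (congrArg Subtype.val (rangeIs_cons.1 h))

lemma IsPath.map_liftEdge {μ : List (Edge (infinitePart P))} (h : IsPath μ) :
    IsPath (μ.map liftEdge) := by
  induction μ with
  | nil => exact isPath_nil
  | cons e μ ih =>
    rw [isPath_cons] at h
    exact isPath_cons.2 ⟨h.1.map_liftEdge, ih h.2⟩

lemma src_map_liftEdge (v : {v // ¬ FiniteVertex P v}) (μ : List (Edge (infinitePart P))) :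
    src v.1 (μ.map liftEdge) = (src v μ).1 := by
  induction μ generalizing v with
  | nil => rfl
  | cons e μ ih =>
    rw [List.map_cons, src_cons, src_cons]
    exact ih e.j

lemma exists_map_liftEdge {μ : List (Edge P)} {v : {v // ¬ FiniteVertex P v}} (hμ : IsPath μ)
    (hr : rangeIs μ v.1) (hB : ∀ e ∈ μ, P.B e.i e.j ≠ 0)
    (hs : ¬ FiniteVertex P (src v.1 μ)) :
    ∃ μ' : List (Edge (infinitePart P)), IsPath μ' ∧ rangeIs μ' v ∧ μ'.map liftEdge = μ := by
  induction μ generalizing v with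
  | nil => exact ⟨[], isPath_nil, rangeIs_nil _, rfl⟩
  | cons e μ ih =>
    obtain ⟨v, hv⟩ := v
    obtain rfl : e.i = v := rangeIs_cons.1 hr
    rw [isPath_cons] at hμ
    rw [src_cons] at hs
    have hBμ : ∀ f ∈ μ, P.B f.i f.j ≠ 0 := fun f hf => hB f (by simp [hf])
    have hj : ¬ FiniteVertex P e.j := fun hj => hs (hj.src hμ.2 hμ.1 hBμ)
    obtain ⟨e', hi', hj', rfl⟩ := exists_liftEdge (hB e (by simp)) hv hj
    obtain ⟨μ', hμ', hr', rfl⟩ := ih (v := ⟨_, hj⟩) hμ.2 hμ.1 hBμ hs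
    exact ⟨e' :: μ', isPath_cons.2 ⟨hj' ▸ hr', hμ'⟩, rangeIs_cons.2 hi', rfl⟩

lemma ActEq.infinitePart {k l : ℤ} {v : {v // ¬ FiniteVertex P v}} (h : ActEq P k l v.1) :
    ActEq (infinitePart P) k l v := by
  intro μ hμ hr
  have := h _ hμ.map_liftEdge hr.map_liftEdge
  rw [act_map_liftEdge, act_map_liftEdge] at this
  exact (List.map_injective_iff.2 liftEdge_injective) this

/-- On a finite graph, the paths `eν` with `s(e)` finite have a common denominator for the
fractions `B_ν / (A_e A_ν)`. -/
lemma exists_denominator [Finite V] :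
    ∃ K : ℕ, 0 < K ∧ ∀ (e : Edge P) (ν : List (Edge P)), FiniteVertex P e.j → IsPath ν →
      rangeIs ν e.j → ((P.A e.i e.j * Aprod ν : ℕ) : ℤ) ∣ K * Bprod ν := by
  cases nonempty_fintype V
  have h : ∀ v : V, ∃ M : ℕ, 0 < M ∧ (FiniteVertex P v → ∀ μ : List (Edge P), IsPath μ →
      rangeIs μ v → (Aprod μ : ℤ) ∣ M * Bprod μ) := by
    intro v
    by_cases hv : FiniteVertex P v
    · obtain ⟨M, hM, h⟩ := finiteVertex_iff.1 hv
      exact ⟨M, hM, fun _ => h⟩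
    · exact ⟨1, one_pos, fun h => absurd h hv⟩
  choose M hM h using h
  refine ⟨(∏ p : V × V, max 1 (P.A p.1 p.2)) * ∏ v, M v,
    Nat.mul_pos (Finset.prod_pos fun _ _ => by positivity) (Finset.prod_pos fun v _ => hM v),
    fun e ν he hν hr => ?_⟩
  have h1 : P.A e.i e.j ∣ ∏ p : V × V, max 1 (P.A p.1 p.2) := by
    have := Finset.dvd_prod_of_mem (fun p : V × V => max 1 (P.A p.1 p.2))
      (Finset.mem_univ (e.i, e.j))
    simpa only [max_eq_right (Nat.succ_le_of_lt e.A_pos)] using this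
  have h2 : M e.j ∣ ∏ v, M v := Finset.dvd_prod_of_mem M (Finset.mem_univ _)
  push_cast only [Nat.cast_mul]
  rw [mul_assoc]
  exact mul_dvd_mul (Int.natCast_dvd_natCast.2 h1) ((h e.j he ν hν hr).trans
    (mul_dvd_mul_right (Int.natCast_dvd_natCast.2 h2) _))

/-- Distinct elements act differently at every vertex of the infinite part. -/
lemma ActEq.eq_of_infinitePart [Finite V] {k l : ℤ} {v : {v // ¬ FiniteVertex P v}}
    (h : ActEq (KatsuraPair.infinitePart P) k l v) : k = l := by
  obtain ⟨K, hK, hKd⟩ := exists_denominator (P := P)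
  have key : ∀ μ : List (Edge P), IsPath μ → rangeIs μ v.1 →
      (Aprod μ : ℤ) ∣ (k - l) * K * Bprod μ := by
    intro μ
    induction μ generalizing k l v with
    | nil => simp [Aprod]
    | cons e μ ih =>
      intro hμ hr
      obtain ⟨v, hv⟩ := v
      obtain rfl : e.i = v := rangeIs_cons.1 hr
      rw [isPath_cons] at hμ
      rw [Bprod_cons]
      by_cases hB : P.B e.i e.j = 0
      · simp [hB]
      by_cases hj : FiniteVertex P e.j
      · rw [Aprod_cons]
        have h1 := (hKd e μ hj hμ.2 hμ.1).mul_left ((k - l) * P.B e.i e.j)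
        rwa [mul_mul_mul_comm] at h1
      · obtain ⟨e', hi', hj', rfl⟩ := exists_liftEdge hB hv hj
        rw [← hi'] at h
        obtain ⟨hd, hν⟩ := h.edge
        have hs := edgeRes_sub_mul hd
        rw [infinitePart_A_of_edge] at hs
        have h1 := mul_dvd_mul_left (P.A e'.i.1 e'.j.1 : ℤ) (ih hν hμ.2 hμ.1)
        have h2 : (P.A e'.i.1 e'.j.1 : ℤ) * ((edgeRes k e' - edgeRes l e') * K * Bprod μ) =
            (k - l) * K * (P.B e'.i.1 e'.j.1 * Bprod μ) := by
          change _ = (k - l) * P.B e'.i.1 e'.j.1 at hs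
          linear_combination (K * Bprod μ : ℤ) * hs
        rw [Aprod_cons, Nat.cast_mul]
        exact h1.trans (dvd_of_eq h2)
  by_contra hkl
  refine v.2 (finiteVertex_iff.2 ⟨(k - l).natAbs * K,
    Nat.mul_pos (Int.natAbs_pos.2 (sub_ne_zero.2 hkl)) hK, fun μ hμ hr => ?_⟩)
  have h1 := key μ hμ hr
  rw [← Int.natAbs_dvd_natAbs] at h1 ⊢
  simpa [Int.natAbs_mul, Int.natAbs_abs] using h1

lemma Contracting.infinitePart (h : Contracting P) :
    Contracting (KatsuraPair.infinitePart P) := by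
  obtain ⟨F, hF⟩ := h
  refine ⟨F, fun k v => ?_⟩
  obtain ⟨n, hn⟩ := hF k v.1
  refine ⟨n, fun μ hμ hr hlen => ?_⟩
  obtain ⟨l, hl, hact⟩ := hn _ hμ.map_liftEdge hr.map_liftEdge (by simpa using hlen)
  rw [res_map_liftEdge, src_map_liftEdge] at hact
  exact ⟨l, hl, hact.infinitePart⟩

lemma Contracting.of_infinitePart [Finite V] (h : Contracting (KatsuraPair.infinitePart P)) :
    Contracting P := by
  cases nonempty_fintype V
  obtain ⟨F, hF⟩ := h
  have hfin : ∀ v : V, ∃ G : Finset ℤ, FiniteVertex P v → ∀ k, ∃ l ∈ G, ActEq P k l v := by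
    intro v
    by_cases hv : FiniteVertex P v
    · obtain ⟨M, hM, h⟩ := hv.exists_actEq_emod
      have hM' : (0 : ℤ) < M := by exact_mod_cast hM
      exact ⟨Finset.Ico 0 (M : ℤ), fun _ k => ⟨k % M,
        Finset.mem_Ico.2 ⟨Int.emod_nonneg _ hM'.ne', Int.emod_lt_of_pos _ hM'⟩, h k⟩⟩
    · exact ⟨∅, fun h => absurd h hv⟩
  choose G hG using hfin
  refine ⟨insert 0 (F ∪ Finset.univ.biUnion G), fun k v => ?_⟩
  have hn : ∃ n : ℕ, ∀ hv : ¬ FiniteVertex P v, ∀ μ : List (Edge (KatsuraPair.infinitePart P)),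
      IsPath μ → rangeIs μ ⟨v, hv⟩ → n ≤ μ.length →
      ∃ l ∈ F, ActEq (KatsuraPair.infinitePart P) (res k μ) l (src ⟨v, hv⟩ μ) := by
    by_cases hv : FiniteVertex P v
    · exact ⟨0, fun h => absurd hv h⟩
    · obtain ⟨n, hn⟩ := hF k ⟨v, hv⟩
      exact ⟨n, fun _ => hn⟩
  obtain ⟨n, hn⟩ := hn
  refine ⟨n, fun μ hμ hr hlen => ?_⟩
  by_cases hs : FiniteVertex P (src v μ)
  · obtain ⟨l, hl, hact⟩ := hG _ hs (res k μ)
    refine ⟨l, ?_, hact⟩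
    simp only [Finset.mem_insert, Finset.mem_union, Finset.mem_biUnion, Finset.mem_univ, true_and]
    exact Or.inr (Or.inr ⟨_, hl⟩)
  refine ⟨res k μ, ?_, fun _ _ _ => rfl⟩
  by_cases hB : ∃ e ∈ μ, P.B e.i e.j = 0
  · simp [res_eq_zero hB]
  push Not at hB
  have hv : ¬ FiniteVertex P v := fun hv => hs (hv.src hμ hr hB)
  obtain ⟨μ', hμ', hr', rfl⟩ := exists_map_liftEdge (v := ⟨v, hv⟩) hμ hr hB hs
  obtain ⟨l, hl, hact⟩ := hn hv μ' hμ' hr' (by simpa using hlen)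
  rw [res_map_liftEdge, hact.eq_of_infinitePart]
  simp [hl]

end KatsuraPair

open KatsuraPair in
/-- the KEP-action `(G_B, E_A)` is contracting iff the KEP-action of the
infinite part `(A_∞, B_∞)` is contracting. -/
theorem statement3 (N : ℕ) (hN : 0 < N) (P : KatsuraPair (Fin N)) :
    Contracting P ↔ Contracting (infinitePart P) := by
  exact ⟨Contracting.infinitePart, Contracting.of_infinitePart⟩
end

section
/- Let ξ = (ξ⁰,ξ¹): H → E be an embedding pair. If μ ∈ E^{-∞} satisfies μ_j ∉ H¹_ξ for infinitely many j < 0, then for every ν ∈ E^{-∞}, μ ∼_ae ν implies μ = ν. -/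
open scoped Classical

/-- An embedding pair `ξ = (ξ⁰,ξ¹) : H → E`: two injective homomorphisms of finite directed
graphs that agree on vertices and have disjoint images on edges. -/
structure EmbPair where
  HV : Type
  HE : Type
  EV : Type
  EE : Type
  finHV : Fintype HV
  finHE : Fintype HE
  finEV : Fintype EV
  finEE : Fintype EE
  rH : HE → HV
  sH : HE → HV
  rE : EE → EV
  sE : EE → EV
  ξV : HV → EV
  ξ0 : HE → EE
  ξ1 : HE → EE
  injV : Function.Injective ξV
  inj0 : Function.Injective ξ0
  inj1 : Function.Injective ξ1
  r0 : ∀ h, rE (ξ0 h) = ξV (rH h)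
  s0 : ∀ h, sE (ξ0 h) = ξV (sH h)
  r1 : ∀ h, rE (ξ1 h) = ξV (rH h)
  s1 : ∀ h, sE (ξ1 h) = ξV (sH h)
  disj : ∀ h h', ξ0 h ≠ ξ1 h'

namespace EmbPair

variable (X : EmbPair)

/-- `H¹_ξ = ξ⁰(H¹) ∪ ξ¹(H¹)`. -/
def Hxi : Set X.EE := Set.range X.ξ0 ∪ Set.range X.ξ1

/-- The action of `(m,v)` on an edge `e` with `r(e) = v`: it fixes `e ∉ H¹_ξ`, and maps
`ξ^i(h)` to `ξ^j(h)` where `m + i = 2n + j`, `j ∈ {0,1}`. -/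
noncomputable def edgeAct (m : ℤ) (e : X.EE) : X.EE :=
  if h0 : ∃ h, X.ξ0 h = e then
    (if m % 2 = 0 then X.ξ0 h0.choose else X.ξ1 h0.choose)
  else if h1 : ∃ h, X.ξ1 h = e then
    (if (m + 1) % 2 = 0 then X.ξ0 h1.choose else X.ξ1 h1.choose)
  else e

/-- The restriction of `(m,v)` along an edge `e` with `r(e) = v`: it is `0` when
`e ∉ H¹_ξ`, and `n` with `m + i = 2n + j`, `j ∈ {0,1}`, when `e = ξ^i(h)`. -/
noncomputable def edgeRes (m : ℤ) (e : X.EE) : ℤ :=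
  if _ : ∃ h, X.ξ0 h = e then m / 2
  else if _ : ∃ h, X.ξ1 h = e then (m + 1) / 2
  else 0

/-- Action on finite paths: `(m,v)·(eν) = ((m,v)·e)((m,v)|_e·ν)`. -/
noncomputable def act : ℤ → List X.EE → List X.EE
  | _, [] => []
  | m, e :: ν => X.edgeAct m e :: act (X.edgeRes m e) ν

/-- Restriction along finite paths: `(m,v)|_{eν} = ((m,v)|_e)|_ν`. -/
noncomputable def res : ℤ → List X.EE → ℤ
  | m, [] => m
  | m, e :: ν => res (X.edgeRes m e) ν

/-- A finite path in `E`. -/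
def IsPath (μ : List X.EE) : Prop := μ.Chain' (fun e f => X.sE e = X.rE f)

/-- `r(μ) = v` (vacuously true for the empty path). -/
def rangeIs (μ : List X.EE) (v : X.EV) : Prop := ∀ e ∈ μ.head?, X.rE e = v

/-- The source of a path with range `v`. -/
def src (v : X.EV) (μ : List X.EE) : X.EV := (μ.getLast?).elim v X.sE

/-- A left-infinite path `⋯μ₋₂μ₋₁` in `E`; index `p : ℕ` encodes position `-(p+1)`. -/
def IsLPath (μ : ℕ → X.EE) : Prop := ∀ n, X.sE (μ (n + 1)) = X.rE (μ n)

/-- The finite segment `μ₋ₖ⋯μ₋₁` of a left-infinite path. -/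
def seg (μ : ℕ → X.EE) (k : ℕ) : List X.EE := ((List.range k).reverse).map μ

/-- Asymptotic equivalence of left-infinite paths in `E`. -/
def AsympEquiv (μ ν : ℕ → X.EE) : Prop :=
  ∃ F : Finset ℤ, ∃ g : ℕ → ℤ, ∀ n : ℕ,
    g n ∈ F ∧ X.rE (μ n) = X.rE (ν n) ∧ X.act (g n) (X.seg μ (n + 1)) = X.seg ν (n + 1)

/-- `ξ^b` for a bit `b`. -/
def xiB (b : Bool) : X.HE → X.EE := fun h => bif b then X.ξ1 h else X.ξ0 h

end EmbPair

namespace EmbPair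

theorem edgeAct_zero (X : EmbPair) (e : X.EE) : X.edgeAct 0 e = e := by
  unfold edgeAct
  split_ifs with h0 _ h1
  · exact h0.choose_spec
  all_goals first | omega | rfl | exact h1.choose_spec

theorem edgeRes_zero (X : EmbPair) (e : X.EE) : X.edgeRes 0 e = 0 := by
  unfold edgeRes
  split_ifs <;> norm_num

theorem act_zero (X : EmbPair) (l : List X.EE) : X.act 0 l = l := by
  induction l with
  | nil => rfl
  | cons e l ih => rw [act, edgeAct_zero, edgeRes_zero, ih]

theorem edgeRes_of_notMem_Hxi (X : EmbPair) (m : ℤ) {e : X.EE} (he : e ∉ X.Hxi) :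
    X.edgeRes m e = 0 := by
  simp only [Hxi, Set.mem_union, Set.mem_range, not_or] at he
  rw [edgeRes, dif_neg he.1, dif_neg he.2]

theorem seg_succ (X : EmbPair) (μ : ℕ → X.EE) (k : ℕ) :
    X.seg μ (k + 1) = μ k :: X.seg μ k := by
  simp [seg, List.range_succ]

theorem eq_of_seg_eq (X : EmbPair) {μ ν : ℕ → X.EE} {k n : ℕ}
    (h : X.seg μ k = X.seg ν k) (hn : n < k) : μ n = ν n :=
  List.map_inj_left.mp h n (by simpa using hn)

end EmbPair

open EmbPair in
/-- if a left-infinite path `μ` has `μ_j ∉ H¹_ξ` for infinitely many `j < 0`,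
then `μ` is asymptotically equivalent only to itself. -/
theorem statement13 (X : EmbPair) (μ : ℕ → X.EE) (hμ : X.IsLPath μ)
    (hinf : ∀ K : ℕ, ∃ p : ℕ, K ≤ p ∧ μ p ∉ X.Hxi) :
    ∀ ν : ℕ → X.EE, X.IsLPath ν → X.AsympEquiv μ ν → μ = ν := by
  rintro ν - ⟨F, g, hg⟩
  funext n
  obtain ⟨p, hnp, hp⟩ := hinf (n + 1)
  have h := (hg p).2.2
  rw [seg_succ, seg_succ, act, edgeRes_of_notMem_Hxi X _ hp, act_zero] at h
  exact eq_of_seg_eq X (List.cons.inj h).2 hnp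
end
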